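/- Let p_j^d denote the number of compositions ω with |ω| ≤ d, |ω| ≡ d (mod 2) and |ω|' = d − j, and let b_j^d denote the number of marked compositions x with |x| ≤ d, |x| ≡ d (mod 2) and |x|' = d − j. Then: if d ≥ 1 is odd, p_j^d = b_{j−1}^{d−1} for every j ≥ 1; if d ≥ 2 is even, p_j^d = b_{j−1}^{d−1} for every 1 ≤ j ≤ d−1, and p_d^d = b_{d−1}^{d−1} + 1. (This is the generating-function identity G(P̄_d;t) − 1 = t·G(B_{d−1};t) for odd d, and G(P̄_d;t) − 1 = t·G(B_{d−1};t) + t^d for even d.) -/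

import Mathlib

/-- A composition: a (possibly empty) list of positive integers. -/
abbrev Comp : Type := List PNat

/-- A marked composition: a composition together with a mark `κ : ℕ`. -/
abbrev MComp : Type := List PNat × ℕ

/-- The norm `|ω|` of a composition. -/
def normC (ω : Comp) : ℕ := (ω.map fun a => (a : ℕ)).sum

/-- The reduced norm `|ω|' = |ω| - ℓ` of a composition. -/
def rnormC (ω : Comp) : ℕ := normC ω - ω.length

/-- The norm of a marked composition. -/
def normM (x : MComp) : ℕ := normC x.1 + x.2

/-- The reduced norm of a marked composition. -/
def rnormM (x : MComp) : ℕ := rnormC x.1 + x.2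

/-- Merge the parts at (0-indexed) positions `k` and `k+1` of a composition. -/
def mergeAux : Comp → ℕ → Comp
  | a :: b :: t, 0 => (a + b) :: t
  | a :: t, n + 1 => a :: mergeAux t n
  | l, _ => l

/-- The merge operation `M_k^∞` (`0 ≤ k ≤ ℓ`) on marked compositions:
`M_0^∞` moves the first part to the mark, `M_ℓ^∞` moves the last part to the mark, and
for `1 ≤ k ≤ ℓ-1`, `M_k^∞` merges the `k`-th and `(k+1)`-st parts (1-indexed). -/
def mergeM (x : MComp) (k : ℕ) : MComp :=
  if k = 0 then
    match x.1 with
    | [] => x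
    | a :: t => (t, x.2 + (a : ℕ))
  else if k = x.1.length then
    match x.1.getLast? with
    | none => x
    | some a => (x.1.dropLast, x.2 + (a : ℕ))
  else (mergeAux x.1 (k - 1), x.2)

/-- The insert operation `I_k` (`0 ≤ k ≤ ℓ`): insert a part `2` after the first `k` parts. -/
def insertC (ω : Comp) (k : ℕ) : Comp := ω.take k ++ (2 : PNat) :: ω.drop k

/-- The insert operation `I_k^∞` on marked compositions. -/
def insertM (x : MComp) (k : ℕ) : MComp := (insertC x.1 k, x.2)

/-- One merge or insert step on marked compositions: `mstep y x` means `x` is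
obtained from `y` by a single operation. -/
def mstep (y x : MComp) : Prop :=
  (∃ k ≤ y.1.length, y.1 ≠ [] ∧ x = mergeM y k) ∨ ∃ k ≤ y.1.length, x = insertM y k

/-- `mprec x y` is the relation `x ⪯ y` on marked compositions. -/
def mprec (x y : MComp) : Prop := Relation.ReflTransGen mstep y x

/-- One merge or insert step on compositions: merges `M_j`, `1 ≤ j ≤ ℓ-1`
(0-indexed: positions `k, k+1` with `k + 2 ≤ ℓ`), and all inserts. -/
def cstep (y x : Comp) : Prop :=
  (∃ k, k + 2 ≤ y.length ∧ x = mergeAux y k) ∨ ∃ k ≤ y.length, x = insertC y k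

/-- `cprec x y` is the relation `x ⪯ y` on compositions. -/
def cprec (x y : Comp) : Prop := Relation.ReflTransGen cstep y x

/-- `p_j^d`: the number of compositions `ω` with `|ω| ≤ d`, `|ω| ≡ d (mod 2)`,
`|ω|' = d - j`. -/
noncomputable def pnum (d j : ℕ) : ℕ :=
  {ω : Comp | normC ω ≤ d ∧ normC ω % 2 = d % 2 ∧
    (rnormC ω : ℤ) = (d : ℤ) - (j : ℤ)}.ncard

/-- `b_j^d`: the number of marked compositions `x` with `|x| ≤ d`, `|x| ≡ d (mod 2)`,
`|x|' = d - j`. -/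
noncomputable def bnum (d j : ℕ) : ℕ :=
  {x : MComp | normM x ≤ d ∧ normM x % 2 = d % 2 ∧
    (rnormM x : ℤ) = (d : ℤ) - (j : ℤ)}.ncard

theorem normC_nil : normC [] = 0 := by simp [normC]

theorem normC_cons (a : PNat) (t : Comp) : normC (a :: t) = (a : ℕ) + normC t := by
  simp [normC]

theorem length_le_normC (ω : Comp) : ω.length ≤ normC ω := by
  induction ω with
  | nil => simp
  | cons a t ih =>
    have := a.pos
    simp only [normC_cons, List.length_cons] at *
    omega

theorem finite_normC_le (n : ℕ) : {ω : Comp | normC ω ≤ n}.Finite := by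
  induction n with
  | zero =>
    refine (Set.finite_singleton ([] : Comp)).subset ?_
    intro ω h
    have h1 := length_le_normC ω
    simp only [Set.mem_ofPred_eq] at h
    exact List.length_eq_zero_iff.mp (by omega)
  | succ n ih =>
    refine (((Set.finite_Iic (Nat.succPNat n)).image2 List.cons ih).insert []).subset ?_
    rintro (_ | ⟨a, t⟩) h
    · exact Set.mem_insert _ _
    · have := a.pos
      simp only [Set.mem_ofPred_eq, normC_cons] at h
      refine Set.mem_insert_of_mem _ ⟨a, ?_, t, ?_, rfl⟩
      · rw [Set.mem_Iic, ← PNat.coe_le_coe, Nat.succPNat_coe]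
        omega
      · simp only [Set.mem_ofPred_eq]
        omega

/-- Turn the mark `κ` into a new first part `κ + 1`. -/
def consMark (x : MComp) : Comp := Nat.succPNat x.2 :: x.1

theorem consMark_injective : Function.Injective consMark := by
  rintro ⟨t, k⟩ ⟨t', k'⟩ h
  simp only [consMark, List.cons.injEq] at h
  rw [Prod.mk.injEq]
  exact ⟨h.2, Nat.succPNat_injective h.1⟩

theorem normC_consMark (x : MComp) : normC (consMark x) = normM x + 1 := by
  simp only [consMark, normC_cons, normM, Nat.succPNat_coe]
  omega

theorem rnormC_consMark (x : MComp) : rnormC (consMark x) = rnormM x := by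
  have h := length_le_normC x.1
  have h2 := normC_consMark x
  simp only [rnormC, rnormM, h2, normM]
  simp only [consMark, List.length_cons]
  omega

theorem exists_consMark (a : PNat) (t : Comp) : ∃ x, consMark x = a :: t :=
  ⟨(t, a.natPred), by simp [consMark]⟩

theorem bnum_eq (d j : ℕ) (hd : 1 ≤ d) (hj : 1 ≤ j) :
    bnum (d - 1) (j - 1) = {ω : Comp | ω ≠ [] ∧ normC ω ≤ d ∧ normC ω % 2 = d % 2 ∧
      (rnormC ω : ℤ) = (d : ℤ) - (j : ℤ)}.ncard := by
  rw [bnum, ← Set.ncard_image_of_injective _ consMark_injective]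
  congr 1
  ext ω
  simp only [Set.mem_image, Set.mem_ofPred_eq]
  constructor
  · rintro ⟨x, hx, rfl⟩
    rw [normC_consMark, rnormC_consMark]
    refine ⟨by simp [consMark], ?_⟩
    omega
  · rintro ⟨h0, h⟩
    cases ω with
    | nil => exact absurd rfl h0
    | cons a t =>
      obtain ⟨x, hx⟩ := exists_consMark a t
      rw [← hx, normC_consMark, rnormC_consMark] at h
      refine ⟨x, ?_, hx⟩
      omega

theorem pnum_eq (d j : ℕ) (hd : 1 ≤ d) (hj : 1 ≤ j) (h : d % 2 = 1 ∨ d ≠ j) :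
    pnum d j = bnum (d - 1) (j - 1) := by
  rw [bnum_eq d j hd hj, pnum]
  congr 1
  ext ω
  simp only [Set.mem_ofPred_eq]
  refine ⟨fun h' => ⟨?_, h'⟩, fun h' => h'.2⟩
  rintro rfl
  simp only [rnormC, normC_nil, List.length_nil] at h'
  omega

/-- If `d ≥ 1` is odd then `p_j^d = b_{j-1}^{d-1}` for every `j ≥ 1`;
if `d ≥ 2` is even then `p_j^d = b_{j-1}^{d-1}` for `1 ≤ j ≤ d-1` and
`p_d^d = b_{d-1}^{d-1} + 1`. -/
theorem cell_count_recursion (d : ℕ) :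
    (d % 2 = 1 → 1 ≤ d → ∀ j : ℕ, 1 ≤ j → pnum d j = bnum (d - 1) (j - 1)) ∧
    (d % 2 = 0 → 2 ≤ d →
      (∀ j : ℕ, 1 ≤ j → j ≤ d - 1 → pnum d j = bnum (d - 1) (j - 1)) ∧
      pnum d d = bnum (d - 1) (d - 1) + 1) := by
  refine ⟨fun h1 h2 j hj => pnum_eq d j h2 hj (Or.inl h1), fun h1 h2 => ⟨fun j hj hj' =>
    pnum_eq d j (by omega) hj (Or.inr (by omega)), ?_⟩⟩
  rw [bnum_eq d d (by omega) (by omega), pnum, ← Set.ncard_insert_of_notMem (a := ([] : Comp)) _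
    ((finite_normC_le d).subset fun ω h => h.2.1)]
  · congr 1
    ext ω
    simp only [Set.mem_ofPred_eq, Set.mem_insert_iff]
    constructor
    · intro h
      by_cases h0 : ω = []
      · exact Or.inl h0
      · exact Or.inr ⟨h0, h⟩
    · rintro (rfl | h)
      · simp only [rnormC, normC_nil, List.length_nil]
        omega
      · exact h.2
  · simp
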